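/- Let C be the middle-third Cantor set, let N be a positive integer, and set α = 1/3 + 1/3^N and β = 1/(3^{N−1}+1). In Schmidt's (α,β)-game played on C with Black's initial ball U(0) = B(0,1), player Black has a strategy guaranteeing that for every k his k-th ball is U(k) = B(0, 3^{−Nk}); in particular, Black can force the unique intersection point of the nested balls of the game to be 0, a point not in BA(1,1). -/

import Mathlib

open Metric

noncomputable section

/-- Badly approximable real numbers: ⟨qx⟩ > C/q for all positive integers q. -/
def BAone : Set ℝ :=
  {x | ∃ C : ℝ, 0 < C ∧ ∀ q : ℕ, 0 < q →
    |(q : ℝ) * x - (round ((q : ℝ) * x) : ℤ)| > C / (q : ℝ)}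

section Game

variable {E : Type*} [MetricSpace E]

/-- Legality of Black's k-th move in the (α,β)-Schmidt game on K with initial radius ρ. -/
def BlackLegal (K : Set E) (α β ρ : ℝ) (b w : ℕ → E) : ℕ → Prop
  | 0 => b 0 ∈ K
  | k + 1 => b (k + 1) ∈ K ∧
      closedBall (b (k + 1)) ((α * β) ^ (k + 1) * ρ) ⊆
        closedBall (w k) (α * ((α * β) ^ k * ρ))

/-- Legality of White's k-th move. -/
def WhiteLegal (K : Set E) (α β ρ : ℝ) (b w : ℕ → E) (k : ℕ) : Prop :=
  w k ∈ K ∧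
    closedBall (w k) (α * ((α * β) ^ k * ρ)) ⊆ closedBall (b k) ((α * β) ^ k * ρ)

/-- White has a strategy, in the (α,β)-game on K starting from Black's ball B(x₀,ρ),
which always produces legal moves and forces property P of Black's sequence of centers. -/
def WhiteCanForce (K : Set E) (α β : ℝ) (x₀ : E) (ρ : ℝ) (P : (ℕ → E) → Prop) : Prop :=
  ∃ f : List E → E, ∀ b : ℕ → E, b 0 = x₀ →
    ∀ w : ℕ → E, (∀ k, w k = f (List.ofFn fun i : Fin (k + 1) => b (i : ℕ))) →
      (∀ k, (∀ j, j ≤ k → BlackLegal K α β ρ b w j) → WhiteLegal K α β ρ b w k) ∧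
      ((∀ k, BlackLegal K α β ρ b w k) → P b)

/-- The target set S is (α,β)-winning for the Schmidt game played on K. -/
def ABWinning (K S : Set E) (α β : ℝ) : Prop :=
  ∀ x₀ ∈ K, ∀ ρ : ℝ, 0 < ρ → ρ ≤ diam K →
    WhiteCanForce K α β x₀ ρ (fun b =>
      ∀ z : E, (∀ k, z ∈ closedBall (b k) ((α * β) ^ k * ρ)) → z ∈ S)

end Game


/-- Below `2 / 3 ^ (n + 1)`, the Cantor set only has points in `[0, 1 / 3 ^ (n + 1)]`. -/
lemma cantorSet_le_third_of_lt {n : ℕ} {x : ℝ} (hx : x ∈ cantorSet)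
    (hlt : x < 2 / 3 * (3⁻¹ : ℝ) ^ n) : x ≤ (3⁻¹ : ℝ) ^ n / 3 := by
  induction n generalizing x with
  | zero =>
    rw [cantorSet_eq_union_halves] at hx
    rcases hx with ⟨y, hy, rfl⟩ | ⟨y, hy, rfl⟩ <;>
      have := cantorSet_subset_unitInterval hy <;>
      simp only [Set.mem_Icc, pow_zero] at * <;> linarith
  | succ n ih =>
    have hpow : (3⁻¹ : ℝ) ^ n ≤ 1 := pow_le_one₀ (by norm_num) (by norm_num)
    rw [pow_succ] at hlt ⊢
    rw [cantorSet_eq_union_halves] at hx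
    rcases hx with ⟨y, hy, rfl⟩ | ⟨y, hy, rfl⟩
    · dsimp only at hlt ⊢
      linarith [ih hy (by linarith)]
    · have := (cantorSet_subset_unitInterval hy).1
      dsimp only at hlt
      linarith

lemma zero_notMem_BAone : (0 : ℝ) ∉ BAone := by
  rintro ⟨C, hC, h⟩
  have := h 1 one_pos
  norm_num at this
  linarith

/-- **Black's strategy on the Cantor set (Fishman, proof of Proposition 5.1).** With
α = 1/3 + 1/3^N and β = 1/(3^{N-1}+1), in the (α,β)-game on the Cantor set starting from
U(0) = B(0,1), Black has a (legal) strategy keeping all his centers at 0, so that his k-th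
ball is B(0,3^{-Nk}); consequently the intersection point of the game is 0 ∉ BA(1,1). -/
theorem black_strategy_cantor (N : ℕ) (hN : 0 < N) (α β : ℝ)
    (hα : α = 1 / 3 + 1 / (3 : ℝ) ^ N) (hβ : β = 1 / ((3 : ℝ) ^ (N - 1) + 1)) :
    ∃ g : List ℝ → ℝ,
      ∀ b w : ℕ → ℝ, b 0 = 0 →
        (∀ k, b (k + 1) = g (List.ofFn fun i : Fin (k + 1) => w (i : ℕ))) →
        (∀ k, WhiteLegal cantorSet α β 1 b w k) →
        (∀ k, b k = 0) ∧
        (∀ k, BlackLegal cantorSet α β 1 b w k) ∧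
        (∀ k, (α * β) ^ k * 1 = ((3 : ℝ) ^ N)⁻¹ ^ k) ∧
        (∀ z : ℝ, (∀ k, z ∈ closedBall (b k) ((α * β) ^ k * 1)) → z = 0) ∧
        (0 : ℝ) ∉ BAone := by
  have h3 : (3 : ℝ) ^ N = 3 * 3 ^ (N - 1) := by
    rw [← pow_succ', Nat.sub_add_cancel hN]
  have hαβ : α * β = ((3 : ℝ) ^ N)⁻¹ := by
    rw [hα, hβ, h3]
    field_simp
  have hα' : α = 1 / 3 + ((3 : ℝ) ^ N)⁻¹ := by rw [hα, one_div ((3 : ℝ) ^ N)]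
  have hr : ∀ k, (α * β) ^ k = (3⁻¹ : ℝ) ^ (N * k) := fun k => by
    rw [hαβ, ← inv_pow, ← pow_mul]
  have hNpos : (0 : ℝ) < ((3 : ℝ) ^ N)⁻¹ := by positivity
  refine ⟨fun _ => 0, fun b w hb0 hb hw => ?_⟩
  have hb' : ∀ k, b k = 0 := fun k => by
    cases k with
    | zero => exact hb0
    | succ k => exact hb k
  refine ⟨hb', fun k => ?_, fun k => by rw [hαβ, mul_one], fun z hz => ?_, zero_notMem_BAone⟩
  · cases k with
    | zero => exact Set.mem_of_eq_of_mem hb0 zero_mem_cantorSet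
    | succ k =>
      refine ⟨Set.mem_of_eq_of_mem (hb' (k + 1)) zero_mem_cantorSet, ?_⟩
      obtain ⟨hwK, hsub⟩ := hw k
      have hw0 := (cantorSet_subset_unitInterval hwK).1
      have hrpos : (0 : ℝ) < (α * β) ^ k := by rw [hr]; positivity
      have hαpos : 0 < α := by rw [hα']; positivity
      have hmem : w k + α * (α * β) ^ k ∈ closedBall (b k) ((α * β) ^ k * 1) := by
        apply hsub
        rw [mem_closedBall, Real.dist_eq, add_sub_cancel_left, mul_one, abs_of_pos (by positivity)]
      rw [hb' k, mem_closedBall, Real.dist_eq, sub_zero, mul_one] at hmem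
      have hle := (le_abs_self _).trans hmem
      have hthird : w k ≤ (α * β) ^ k / 3 := by
        rw [hr] at hle hrpos ⊢
        apply cantorSet_le_third_of_lt hwK
        rw [hα'] at hle
        linarith [mul_pos hNpos hrpos]
      apply closedBall_subset_closedBall'
      rw [hb' (k + 1), Real.dist_eq, zero_sub, abs_neg, abs_of_nonneg hw0, pow_succ, hαβ, hα']
      rw [hαβ] at hthird
      linarith
  · have hlt : α * β < 1 := by
      rw [hαβ]
      exact inv_lt_one_of_one_lt₀ (one_lt_pow₀ (by norm_num) hN.ne')
    have hlim := tendsto_pow_atTop_nhds_zero_of_lt_one (hαβ ▸ hNpos.le) hlt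
    refine abs_nonpos_iff.1 (ge_of_tendsto' hlim fun k => ?_)
    simpa [hb' k] using hz k
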